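/- arXiv:2204.06511 — 2 statements merged into one kernel-verified Lean document; each statement's English description precedes it below -/
import Mathlib

section
/- Let F be a finite field with |F| > D·m, let 𝒦 and 𝒰 be finite index sets, and set T = 𝒦 × 𝒰. For each j ∈ {1,…,m} suppose given indices k_{j,1}, …, k_{j,D} ∈ 𝒦 that are pairwise distinct, and for each s ∈ {1,…,D} a pair u_{j,s}, v_{j,s} ∈ 𝒰 with u_{j,s} ≠ v_{j,s}. Then there exists a function h : T → F^D such that for every j ∈ {1,…,m}, the D×D matrix over F whose s-th column is h(k_{j,s}, u_{j,s}) − h(k_{j,s}, v_{j,s}) is invertible. -/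
open MeasureTheory ProbabilityTheory

/-- Shannon entropy (in whatever base `Real.log` fixes, i.e. nats) of a
finite-valued random variable `X` on `(Ω, μ)`. -/
noncomputable def ent {Ω : Type*} [MeasurableSpace Ω] {S : Type*}
    (μ : Measure Ω) (X : Ω → S) : ℝ :=
  ∑' s : S, Real.negMulLog ((μ (X ⁻¹' {s})).toReal)

/-- Conditional Shannon entropy `H(X | Y) = H(X, Y) - H(Y)`. -/
noncomputable def condEnt {Ω : Type*} [MeasurableSpace Ω] {S T : Type*}
    (μ : Measure Ω) (X : Ω → S) (Y : Ω → T) : ℝ :=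
  ent μ (fun ω => (X ω, Y ω)) - ent μ Y

/-- Mutual information `I(X ; Y) = H(X) + H(Y) - H(X, Y)`. -/
noncomputable def mutInfo {Ω : Type*} [MeasurableSpace Ω] {S T : Type*}
    (μ : Measure Ω) (X : Ω → S) (Y : Ω → T) : ℝ :=
  ent μ X + ent μ Y - ent μ (fun ω => (X ω, Y ω))

/-- Conditional mutual information
`I(X ; Y | Z) = H(X | Z) + H(Y | Z) - H(X, Y | Z)`. -/
noncomputable def condMutInfo {Ω : Type*} [MeasurableSpace Ω] {S T U : Type*}
    (μ : Measure Ω) (X : Ω → S) (Y : Ω → T) (Z : Ω → U) : ℝ :=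
  condEnt μ X Z + condEnt μ Y Z - condEnt μ (fun ω => (X ω, Y ω)) Z

/-- The tuple `W_C = (W_k)_{k ∈ C}` of a family of random variables. -/
def tup {Ω : Type*} {K : ℕ} {𝕎 : Fin K → Type*} (W : ∀ k, Ω → 𝕎 k)
    (C : Finset (Fin K)) : Ω → ∀ k : C, 𝕎 k.1 :=
  fun ω k => W k.1 ω

open Polynomial in
/-- If each of finitely many linear maps into `n × n` matrices over a sufficiently large finite
field hits an invertible matrix, then some vector is sent to an invertible matrix by all of
them. -/
theorem LinearMap.exists_forall_det_ne_zero {F V n ι : Type*} [Field F] [Fintype F]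
    [AddCommGroup V] [Module F V] [Fintype n] [DecidableEq n] (L : ι → V →ₗ[F] Matrix n n F)
    (hL : ∀ i, ∃ x, (L i x).det ≠ 0) (J : Finset ι)
    (hJ : Fintype.card n * J.card < Fintype.card F) :
    ∃ x, ∀ i ∈ J, (L i x).det ≠ 0 := by
  classical
  induction J using Finset.induction_on with
  | empty => exact ⟨0, by simp⟩
  | insert j J hj ih =>
    obtain ⟨x, hx⟩ := ih <| lt_of_le_of_lt
      (Nat.mul_le_mul_left _ (Finset.card_le_card (Finset.subset_insert j J))) hJ
    obtain ⟨y, hy⟩ := hL j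
    let p : ι → F[X] := fun i => ((X : F[X]) • (L i y).map C + (L i x).map C).det
    have hp : ∏ i ∈ insert j J, p i ≠ 0 := by
      refine Finset.prod_ne_zero_iff.2 fun i hi h0 => ?_
      obtain rfl | hi := Finset.mem_insert.1 hi
      · exact hy ((coeff_det_X_add_C_card (L i y) (L i x)).symm.trans
          (congrArg (fun q : F[X] => q.coeff (Fintype.card n)) h0))
      · exact hx i hi ((coeff_det_X_add_C_zero (L i y) (L i x)).symm.trans
          (congrArg (fun q : F[X] => q.coeff 0) h0))
    have hdeg : (∏ i ∈ insert j J, p i).natDegree < Fintype.card F := by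
      refine lt_of_le_of_lt ((natDegree_prod_le _ _).trans ?_) hJ
      rw [mul_comm, ← smul_eq_mul]
      exact Finset.sum_le_card_nsmul _ _ _ fun i _ => natDegree_det_X_add_C_le _ _
    obtain ⟨t, ht⟩ := exists_eval_ne_zero_of_natDegree_lt_card _ hp (by simpa using hdeg)
    refine ⟨t • y + x, fun i hi => ?_⟩
    rw [eval_prod] at ht
    have hti := Finset.prod_ne_zero_iff.1 ht i hi
    have heval : (p i).eval t = (L i (t • y + x)).det := by
      rw [← coe_evalRingHom, RingHom.map_det]
      congr 1
      ext
      simp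
      exact mul_comm _ _
    rwa [heval] at hti

theorem schwartz_zippel_existence_D
    {F : Type} [Field F] [Fintype F]
    {D m : ℕ} (hF : D * m < Fintype.card F)
    {𝒦 𝒰 : Type} [Fintype 𝒦] [Fintype 𝒰]
    (k : Fin m → Fin D → 𝒦) (hk : ∀ j, Function.Injective (k j))
    (u v : Fin m → Fin D → 𝒰) (huv : ∀ j s, u j s ≠ v j s) :
    ∃ h : 𝒦 × 𝒰 → (Fin D → F), ∀ j,
      IsUnit (Matrix.of fun r s : Fin D =>
        h (k j s, u j s) r - h (k j s, v j s) r) := by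
  classical
  let L : Fin m → (𝒦 × 𝒰 → Fin D → F) →ₗ[F] Matrix (Fin D) (Fin D) F := fun j =>
    { toFun := fun h => Matrix.of fun r s => h (k j s, u j s) r - h (k j s, v j s) r
      map_add' := fun _ _ => by ext; simp; ring
      map_smul' := fun _ _ => by ext; simp [mul_sub] }
  have hL : ∀ j, ∃ h, (L j h).det ≠ 0 := fun j => by
    refine ⟨fun q r => if q = (k j r, u j r) then 1 else 0, ?_⟩
    suffices h : L j (fun q r => if q = (k j r, u j r) then 1 else 0) = 1 by simp [h]
    ext r s
    obtain rfl | hrs := eq_or_ne r s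
    · simp [L, (huv j r).symm]
    · simp [L, hrs, (hk j).ne hrs.symm]
  obtain ⟨h, hh⟩ := LinearMap.exists_forall_det_ne_zero L hL Finset.univ (by simpa using hF)
  exact ⟨h, fun j => (Matrix.isUnit_iff_isUnit_det _).2 (hh j (Finset.mem_univ j)).isUnit⟩
end

section
/- Let F be a finite field, let D, K, N, m be positive integers with |F| > 2·D·m, and for each n ∈ {1,…,N} let C_n ⊆ {1,…,K} satisfy 2·|C_n| ≥ D. Suppose given m edges, where edge j consists of two distinct node indices i_j ≠ i'_j in {1,…,N} and a set 𝒟_j ⊆ {1,…,K} with |𝒟_j| = D and C_{i_j} ∪ C_{i'_j} = 𝒟_j. Then there exist matrices H_n ∈ F^{D × 2|C_n|} for n ∈ {1,…,N} such that for every edge j, the linear map F^{2D} → F^{2D} sending a tuple w = (w_k)_{k∈𝒟_j} (with each w_k ∈ F^2) to the pair (H_{i_j}·(w_k)_{k∈C_{i_j}}, H_{i'_j}·(w_k)_{k∈C_{i'_j}}) is bijective, where (w_k)_{k∈C} denotes the column vector in F^{2|C|} stacking the blocks w_k for k ∈ C. -/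
open Polynomial in
/-- Along a line of linear maps between spaces of equal dimension, bijectivity is controlled by a
univariate polynomial of degree at most the dimension. -/
theorem exists_polynomial_bijective_smul_add {F W U : Type*} [Field F]
    [AddCommGroup W] [Module F W] [FiniteDimensional F W]
    [AddCommGroup U] [Module F U] [FiniteDimensional F U]
    (hWU : Module.finrank F W = Module.finrank F U) (f g : W →ₗ[F] U)
    (h : ∃ t : F, Function.Bijective (t • f + g)) :
    ∃ p : F[X], p ≠ 0 ∧ p.natDegree ≤ Module.finrank F W ∧
      ∀ t : F, p.eval t ≠ 0 → Function.Bijective (t • f + g) := by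
  let b := Module.finBasis F W
  let c := (Module.finBasis F U).reindex (finCongr hWU.symm)
  let A := LinearMap.toMatrix b c f
  let B := LinearMap.toMatrix b c g
  let p : F[X] := ((X : F[X]) • A.map C + B.map C).det
  have eval_p (t : F) : p.eval t = (LinearMap.toMatrix b c (t • f + g)).det := by
    rw [map_add, map_smul, ← coe_evalRingHom, RingHom.map_det]
    congr 1
    ext x y
    simp [A, B, mul_comm t]
  refine ⟨p, ?_, ?_, ?_⟩
  · intro hp
    obtain ⟨t, ht⟩ := h
    have hdet := LinearEquiv.isUnit_det (LinearEquiv.ofBijective _ ht) b c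
    refine hdet.ne_zero ?_
    have := eval_p t
    rw [hp, eval_zero] at this
    exact this.symm
  · simpa using natDegree_det_X_add_C_le A B
  · intro t ht
    rw [eval_p] at ht
    exact (LinearEquiv.ofIsUnitDet (isUnit_iff_ne_zero.mpr ht)).bijective

open Polynomial in
/-- If each of finitely many linear families of linear maps contains a bijection, then over a large
enough field a single parameter makes all of them bijective. -/
theorem exists_forall_bijective_of_card_mul_lt {F V ι : Type*} [Field F] [Fintype F]
    [AddCommGroup V] [Module F V] {W U : ι → Type*}
    [∀ e, AddCommGroup (W e)] [∀ e, Module F (W e)] [∀ e, FiniteDimensional F (W e)]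
    [∀ e, AddCommGroup (U e)] [∀ e, Module F (U e)] [∀ e, FiniteDimensional F (U e)]
    (hWU : ∀ e, Module.finrank F (W e) = Module.finrank F (U e)) {d : ℕ}
    (hd : ∀ e, Module.finrank F (W e) ≤ d) (G : ∀ e, V →ₗ[F] W e →ₗ[F] U e)
    (hG : ∀ e, ∃ v, Function.Bijective (G e v)) (s : Finset ι)
    (hs : s.card * d < Fintype.card F) :
    ∃ v, ∀ e ∈ s, Function.Bijective (G e v) := by
  classical
  induction s using Finset.induction_on with
  | empty => exact ⟨0, by simp⟩
  | insert a s ha ih =>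
    obtain ⟨v, hv⟩ := ih (lt_of_le_of_lt
      (Nat.mul_le_mul_right d (Finset.card_le_card (Finset.subset_insert a s))) hs)
    obtain ⟨v', hv'⟩ := hG a
    have key : ∀ e : ↥(insert a s), ∃ p : F[X], p ≠ 0 ∧ p.natDegree ≤ d ∧
        ∀ t : F, p.eval t ≠ 0 → Function.Bijective (G e (t • (v' - v) + v)) := by
      rintro ⟨e, he⟩
      have hline : ∃ t : F, Function.Bijective (t • G e (v' - v) + G e v) := by
        rcases Finset.mem_insert.mp he with rfl | he
        · exact ⟨1, by simpa using hv'⟩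
        · exact ⟨0, by simpa using hv e he⟩
      obtain ⟨p, hp, hdeg, hbij⟩ := exists_polynomial_bijective_smul_add (hWU e) _ _ hline
      exact ⟨p, hp, hdeg.trans (hd e), fun t ht => by simpa using hbij t ht⟩
    choose p hp hdeg hbij using key
    obtain ⟨t, ht⟩ := exists_eval_ne_zero_of_natDegree_lt_card (∏ e, p e)
      (Finset.prod_ne_zero_iff.mpr fun e _ => hp e) (by
        rw [Cardinal.mk_fintype, Nat.cast_lt]
        refine lt_of_le_of_lt ((natDegree_prod_le _ _).trans
          (Finset.sum_le_card_nsmul _ _ d fun e _ => hdeg e)) ?_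
        rwa [Finset.card_univ, Fintype.card_coe, smul_eq_mul])
    rw [eval_prod, Finset.prod_ne_zero_iff] at ht
    exact ⟨t • (v' - v) + v, fun e he => hbij ⟨e, he⟩ t (ht _ (Finset.mem_univ _))⟩

/-- A type of cardinality `2 * D` covered by two sets of size at least `D` splits into two halves,
one inside each set. -/
theorem exists_equiv_sum_of_cover {T : Type*} [Fintype T] [DecidableEq T] {D : ℕ}
    (hT : Fintype.card T = 2 * D) (A B : Finset T) (hA : D ≤ A.card) (hB : D ≤ B.card)
    (hAB : A ∪ B = Finset.univ) :
    ∃ e : Fin D ⊕ Fin D ≃ T, (∀ a, e (Sum.inl a) ∈ A) ∧ ∀ a, e (Sum.inr a) ∈ B := by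
  have hsub : Bᶜ ⊆ A := fun x hx => by
    have : x ∈ A ∪ B := hAB ▸ Finset.mem_univ x
    simp only [Finset.mem_union, Finset.mem_compl] at this hx
    tauto
  obtain ⟨S, hBS, hSA, hS⟩ := Finset.exists_subsuperset_card_eq (n := D) hsub
    (by rw [Finset.card_compl]; omega) hA
  have hS' : Sᶜ.card = D := by rw [Finset.card_compl]; omega
  let e₁ : Fin D ≃ S := (Finset.equivFinOfCardEq hS).symm
  let e₂ : Fin D ≃ {x // x ∉ S} :=
    (Finset.equivFinOfCardEq hS').symm.trans (Equiv.subtypeEquivRight fun x => Finset.mem_compl)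
  refine ⟨(Equiv.sumCongr e₁ e₂).trans (Equiv.sumCompl (· ∈ S)), fun a => hSA ?_, fun a => ?_⟩
  · simp
  · by_contra hb
    exact (e₂ a).2 (hBS (Finset.mem_compl.mpr hb))

/-- The pair of linear maps given by matrices acting on the blocks of `w` indexed by two subsets of
the index set, as a linear function of the family of matrices. -/
def blockPairMap (F : Type*) [Field F] {D N : ℕ} {κ : Type*}
    (C : Fin N → Finset κ) (n n' : Fin N) (E : Finset κ) (h : C n ⊆ E) (h' : C n' ⊆ E) :
    ((n : Fin N) → Matrix (Fin D) (↥(C n) × Fin 2) F) →ₗ[F]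
      (↥E → Fin 2 → F) →ₗ[F] (Fin D → F) × (Fin D → F) :=
  LinearMap.mk₂ F
    (fun H w => ((H n).mulVec (fun p => w ⟨p.1.1, h p.1.2⟩ p.2),
      (H n').mulVec (fun p => w ⟨p.1.1, h' p.1.2⟩ p.2)))
    (fun H H' w => by simp [Matrix.add_mulVec])
    (fun c H w => by simp [Matrix.smul_mulVec])
    (fun H w w' => by
      simp only [Prod.mk_add_mk, ← Matrix.mulVec_add]; rfl)
    (fun c H w => by
      simp only [Prod.smul_mk, ← Matrix.mulVec_smul]; rfl)

/-- Two blocks that cover the index set, each of at least half its size, admit matrices making the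
pair of block maps bijective. -/
theorem exists_bijective_blockPairMap {F κ : Type*} [Field F] [DecidableEq κ] {D N : ℕ}
    (C : Fin N → Finset κ) {n n' : Fin N} (hne : n ≠ n') {E : Finset κ} (h : C n ⊆ E)
    (h' : C n' ⊆ E) (hE : E.card = D) (hn : D ≤ 2 * (C n).card) (hn' : D ≤ 2 * (C n').card)
    (hunion : C n ∪ C n' = E) :
    ∃ H : (n : Fin N) → Matrix (Fin D) (↥(C n) × Fin 2) F,
      Function.Bijective (blockPairMap F C n n' E h h' H) := by
  have hcard (m : Fin N) (hm : C m ⊆ E) :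
      (Finset.univ.filter fun t : ↥E × Fin 2 => t.1.1 ∈ C m).card = 2 * (C m).card := by
    have : (Finset.univ.filter fun t : ↥E × Fin 2 => t.1.1 ∈ C m)
        = (E.attach.filter fun k => k.1 ∈ C m) ×ˢ Finset.univ := by
      ext t; simp
    rw [this, Finset.card_product, Finset.card_univ, Fintype.card_fin, mul_comm,
      ← Finset.card_map (Function.Embedding.subtype _)]
    congr 2
    ext k
    simpa using fun hk => hm hk
  obtain ⟨e, he, he'⟩ := exists_equiv_sum_of_cover (T := ↥E × Fin 2) (D := D)
    (by simp [hE, mul_comm])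
    (Finset.univ.filter fun t => t.1.1 ∈ C n) (Finset.univ.filter fun t => t.1.1 ∈ C n')
    (by rwa [hcard n h]) (by rwa [hcard n' h'])
    (by
      ext t
      have := hunion.ge t.1.2
      simpa using this)
  simp only [Finset.mem_filter, Finset.mem_univ, true_and] at he he'
  let H : (n : Fin N) → Matrix (Fin D) (↥(C n) × Fin 2) F := fun m a p =>
    let t := if m = n then e (Sum.inl a) else e (Sum.inr a)
    if (p.1.1, p.2) = (t.1.1, t.2) then 1 else 0
  have hH (w : ↥E → Fin 2 → F) : blockPairMap F C n n' E h h' H w =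
      (fun a => w (e (Sum.inl a)).1 (e (Sum.inl a)).2,
        fun a => w (e (Sum.inr a)).1 (e (Sum.inr a)).2) := by
    refine Prod.ext (funext fun a => ?_) (funext fun a => ?_)
    · simp only [blockPairMap, LinearMap.mk₂_apply, Matrix.mulVec, dotProduct]
      rw [Finset.sum_eq_single (⟨(e (Sum.inl a)).1.1, he a⟩, (e (Sum.inl a)).2)]
      · simp [H]
      · rintro ⟨⟨k, hk⟩, b⟩ - hkb
        simp only [ne_eq, Prod.mk.injEq, Subtype.mk.injEq] at hkb
        simp [H, hkb]
      · simp
    · simp only [blockPairMap, LinearMap.mk₂_apply, Matrix.mulVec, dotProduct]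
      rw [Finset.sum_eq_single (⟨(e (Sum.inr a)).1.1, he' a⟩, (e (Sum.inr a)).2)]
      · simp [H, hne.symm]
      · rintro ⟨⟨k, hk⟩, b⟩ - hkb
        simp only [ne_eq, Prod.mk.injEq, Subtype.mk.injEq] at hkb
        simp [H, hkb, hne.symm]
      · simp
  refine ⟨H, fun w w' hww => ?_, fun y => ?_⟩
  · rw [hH, hH, Prod.mk.injEq] at hww
    have key (x : Fin D ⊕ Fin D) : w (e x).1 (e x).2 = w' (e x).1 (e x).2 := by
      rcases x with a | a
      · exact congrFun hww.1 a
      · exact congrFun hww.2 a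
    funext k b
    simpa using key (e.symm (k, b))
  · refine ⟨fun k b => Sum.elim y.1 y.2 (e.symm (k, b)), ?_⟩
    rw [hH]
    simp

open MeasureTheory ProbabilityTheory

theorem schwartz_zippel_existence_2D
    {F : Type} [Field F] [Fintype F]
    {D K N m : ℕ} (hD : 0 < D) (hK : 0 < K) (hN : 0 < N) (hm : 0 < m)
    (hF : 2 * D * m < Fintype.card F)
    (C : Fin N → Finset (Fin K)) (hC : ∀ n, D ≤ 2 * (C n).card)
    (i i' : Fin m → Fin N) (hne : ∀ j, i j ≠ i' j)
    (𝒟 : Fin m → Finset (Fin K)) (h𝒟 : ∀ j, (𝒟 j).card = D)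
    (hunion : ∀ j, C (i j) ∪ C (i' j) = 𝒟 j) :
    ∃ H : (n : Fin N) → Matrix (Fin D) (↥(C n) × Fin 2) F, ∀ j,
      Function.Bijective (fun w : ↥(𝒟 j) → Fin 2 → F =>
        ((H (i j)).mulVec (fun p : ↥(C (i j)) × Fin 2 =>
          w ⟨p.1.1, by rw [← hunion j]; exact Finset.mem_union_left _ p.1.2⟩ p.2),
         (H (i' j)).mulVec (fun p : ↥(C (i' j)) × Fin 2 =>
          w ⟨p.1.1, by rw [← hunion j]; exact Finset.mem_union_right _ p.1.2⟩ p.2))) := by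
  have hsub (j) : C (i j) ⊆ 𝒟 j := hunion j ▸ Finset.subset_union_left
  have hsub' (j) : C (i' j) ⊆ 𝒟 j := hunion j ▸ Finset.subset_union_right
  have hrank (j) : Module.finrank F (↥(𝒟 j) → Fin 2 → F) = D * 2 := by
    simp [Module.finrank_pi_fintype, h𝒟]
  obtain ⟨H, hH⟩ := exists_forall_bijective_of_card_mul_lt (d := D * 2)
    (U := fun _ => (Fin D → F) × (Fin D → F))
    (fun j => by rw [hrank, Module.finrank_prod, Module.finrank_fin_fun]; ring)
    (fun j => (hrank j).le)
    (fun j => blockPairMap F C (i j) (i' j) (𝒟 j) (hsub j) (hsub' j))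
    (fun j => exists_bijective_blockPairMap C (hne j) (hsub j) (hsub' j) (h𝒟 j)
      (hC _) (hC _) (hunion j))
    Finset.univ (by rw [Finset.card_univ, Fintype.card_fin]; convert hF using 1; ring)
  exact ⟨H, fun j => hH j (Finset.mem_univ j)⟩
end
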